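/- Let I be a finite index set, m : I → ℝ with m_j > 0 for all j, and let f⁽¹⁾,…,f⁽⁷⁾ : I × I × I → ℂ satisfy the system (E1)–(E7) for all j,k,l ∈ I: (E1) f⁽²⁾_{kjl}·m_l² + i·f⁽⁶⁾_{jkl}·m_j + f⁽²⁾_{ljk}·m_k² + i·f⁽⁶⁾_{jlk}·m_j = 0; (E2) −32·f⁽¹⁾_{jkl} + 2·f⁽²⁾_{kjl} + i·f⁽⁵⁾_{jkl}·m_j = 0; (E3) f⁽²⁾_{jkl} − i·f⁽³⁾_{kjl}·m_k = 0; (E4) f⁽²⁾_{kjl}·m_l + f⁽⁴⁾_{jlk}·m_j = 0; (E5) 2·f⁽³⁾_{jkl} + f⁽⁵⁾_{jkl} + 2i·f⁽⁷⁾_{jkl}·m_k = 0; (E6) f⁽³⁾_{jkl}·m_l² + i·f⁽⁴⁾_{jkl}·m_k + 2·f⁽⁶⁾_{jkl} = 0; (E7) i·f⁽³⁾_{jkl}·m_l + f⁽⁴⁾_{jlk} = 0. Assume moreover f⁽⁵⁾_{jkl} = 0 for all j,k,l (renormalizability). Write f := f⁽¹⁾. Then for all j,k,l ∈ I: f⁽²⁾_{jkl}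 = 16·f_{kjl}; f⁽³⁾_{jkl} = −(16·i/m_j)·f_{jkl}; f⁽⁴⁾_{jkl} = −(16·m_k/m_j)·f_{jlk}; f⁽⁶⁾_{jkl} = (8·i/m_j)·(m_k²·f_{jlk} + m_l²·f_{jkl}); f⁽⁷⁾_{jkl} = (16/(m_j·m_k))·f_{jkl}. -/

import Mathlib

theorem susy_gauge_stmt {I : Type*} [Fintype I] (m : I → ℝ) (hm : ∀ j, 0 < m j)
    (f1 f2 f3 f4 f5 f6 f7 : I → I → I → ℂ)
    (E1 : ∀ j k l : I, f2 k j l * (m l : ℂ)^2 + Complex.I * f6 j k l * (m j : ℂ)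
        + f2 l j k * (m k : ℂ)^2 + Complex.I * f6 j l k * (m j : ℂ) = 0)
    (E2 : ∀ j k l : I, -32 * f1 j k l + 2 * f2 k j l + Complex.I * f5 j k l * (m j : ℂ) = 0)
    (E3 : ∀ j k l : I, f2 j k l - Complex.I * f3 k j l * (m k : ℂ) = 0)
    (E4 : ∀ j k l : I, f2 k j l * (m l : ℂ) + f4 j l k * (m j : ℂ) = 0)
    (E5 : ∀ j k l : I, 2 * f3 j k l + f5 j k l + 2 * Complex.I * f7 j k l * (m k : ℂ) = 0)
    (E6 : ∀ j k l : I, f3 j k l * (m l : ℂ)^2 + Complex.I * f4 j k l * (m k : ℂ) + 2 * f6 j k l = 0)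
    (E7 : ∀ j k l : I, Complex.I * f3 j k l * (m l : ℂ) + f4 j l k = 0)
    (h5 : ∀ j k l : I, f5 j k l = 0)
    :
    ∀ j k l : I,
      f2 j k l = 16 * f1 k j l ∧
      f3 j k l = -(16 * Complex.I / (m j : ℂ)) * f1 j k l ∧
      f4 j k l = -(16 * (m k : ℂ) / (m j : ℂ)) * f1 j l k ∧
      f6 j k l = (8 * Complex.I / (m j : ℂ)) * ((m k : ℂ)^2 * f1 j l k + (m l : ℂ)^2 * f1 j k l) ∧
      f7 j k l = (16 / ((m j : ℂ) * (m k : ℂ))) * f1 j k l := by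
  have hm0 : ∀ j, (m j : ℂ) ≠ 0 := fun j => Complex.ofReal_ne_zero.mpr (hm j).ne'
  have I2 : Complex.I * Complex.I = -1 := Complex.I_mul_I
  have h2 : ∀ j k l, f2 j k l = 16 * f1 k j l := fun j k l => by
    linear_combination (1 / 2) * E2 k j l - (1 / 2) * Complex.I * (m k : ℂ) * h5 k j l
  have h3 : ∀ j k l, f3 j k l = -(16 * Complex.I / (m j : ℂ)) * f1 j k l := fun j k l => by
    have := hm0 j
    field_simp
    linear_combination Complex.I * E3 k j l - Complex.I * h2 k j l + f3 j k l * m j * I2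
  have h4 : ∀ j k l, f4 j k l = -(16 * (m k : ℂ) / (m j : ℂ)) * f1 j l k := fun j k l => by
    have := hm0 j
    field_simp
    linear_combination E4 j l k - (m k : ℂ) * h2 l j k
  intro j k l
  have hj := hm0 j
  have hk := hm0 k
  refine ⟨h2 j k l, h3 j k l, h4 j k l, ?_, ?_⟩
  · have e := E6 j k l
    rw [h3, h4] at e
    field_simp at e ⊢
    linear_combination (1 / 2) * e
  · have e := E5 j k l
    rw [h3, h5] at e
    field_simp at e ⊢
    linear_combination (-Complex.I / 2) * e + (f7 j k l * m j * m k - 16 * f1 j k l) * I2
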